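/- Let (V, ω) be a VOA of CFT type. The map J_1(V) → Aut⁻V, a ↦ exp(a(1)), is an isomorphism of groups, where J_1(V) is regarded as an additive group. -/

import Mathlib

/-!
Common framework: vertex algebras, ℤ-graded (conformal) vertex algebras,
conformal vectors, automorphism groups, following Moriwaki,
"On classification of conformal vectors in vertex operator algebra and
the vertex algebra automorphism group".
-/

noncomputable section

open scoped BigOperators

/-- The generalized binomial coefficient `binom(m, i)` for `m : ℤ`, valued in a field `K`. -/
def zBinom (K : Type*) [Field K] (m : ℤ) (i : ℕ) : K :=
  (∏ j ∈ Finset.range i, ((m : K) - (j : K))) / (Nat.factorial i : K)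

/-- A vertex algebra over a field `K`: a `K`-vector space `V` equipped with bilinear
`n`-th products `a(n)b` (`n : ℤ`) and a vacuum vector `𝟙`, subject to the truncation
condition, the vacuum and creation axioms, and the Borcherds identity. -/
structure VA (K V : Type*) [Field K] [AddCommGroup V] [Module K V] where
  /-- the `n`-th product `a(n)b`, bilinear in `a` and `b` -/
  ncoef : ℤ → V →ₗ[K] V →ₗ[K] V
  /-- the vacuum vector `𝟙` -/
  vac : V
  /-- truncation: `a(n)b = 0` for `n` sufficiently large -/
  trunc : ∀ a b : V, ∃ N : ℤ, ∀ n : ℤ, N ≤ n → ncoef n a b = 0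
  /-- the vacuum axiom `Y(𝟙, z) = id`, i.e. `𝟙(n)a = δ_{n,-1} a` -/
  vac_ncoef : ∀ (n : ℤ) (a : V), ncoef n vac a = if n = -1 then a else 0
  /-- creation: `a(-1)𝟙 = a` -/
  ncoef_vac : ∀ a : V, ncoef (-1) a vac = a
  /-- creation: `a(n)𝟙 = 0` for `n ≥ 0` -/
  ncoef_vac_zero : ∀ n : ℤ, 0 ≤ n → ∀ a : V, ncoef n a vac = 0
  /-- the Borcherds identity -/
  borcherds : ∀ (a b c : V) (p q m : ℤ),
    (∑ᶠ i : ℕ, zBinom K m i •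
        ncoef (m + q - (i : ℤ)) (ncoef (p + (i : ℤ)) a b) c)
      = ∑ᶠ i : ℕ, ((-1 : K) ^ i * zBinom K p i) •
          (ncoef (m + p - (i : ℤ)) a (ncoef (q + (i : ℤ)) b c)
            - ((p.negOnePow : ℤ) : K) •
                ncoef (p + q - (i : ℤ)) b (ncoef (m + (i : ℤ)) a c))

namespace VA

variable {K V : Type*} [Field K] [AddCommGroup V] [Module K V]

/-- The translation operator `T a = a(-2)𝟙`. -/
def T (A : VA K V) : V →ₗ[K] V := (A.ncoef (-2)).flip A.vac

/-- The eigenspace `V_n^a = {v ∈ V | a(1)v = n v}` of `a(1)`. -/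
def eig (A : VA K V) (a : V) (n : ℤ) : Submodule K V :=
  LinearMap.ker (A.ncoef 1 a - (n : K) • (LinearMap.id : V →ₗ[K] V))

/-- `a` is a conformal vector: `a(1)a = 2a`, `a(3)a ∈ K𝟙`, `a(2)a = 0`, `a(n)a = 0`
for `n ≥ 4`, `a(0) = T`, and `a(1)` is semisimple with integer eigenvalues
(`V = ⊕_{n ∈ ℤ} V_n^a`). -/
def IsConformal (A : VA K V) (a : V) : Prop :=
  A.ncoef 1 a a = (2 : K) • a ∧
  (∃ c : K, A.ncoef 3 a a = c • A.vac) ∧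
  A.ncoef 2 a a = 0 ∧
  (∀ n : ℤ, 4 ≤ n → A.ncoef n a a = 0) ∧
  A.ncoef 0 a = A.T ∧
  DirectSum.IsInternal (A.eig a)

/-- `a` is a conformal vector of CFT type: `(V, a)` is a VOA of CFT type, i.e.
`V = ⊕_{n ∈ ℕ} V_n^a` with finite-dimensional pieces and `V_0^a = K𝟙`. -/
def IsConformalCFT (A : VA K V) (a : V) : Prop :=
  A.IsConformal a ∧
  (∀ n : ℤ, n < 0 → A.eig a n = ⊥) ∧
  (∀ n : ℤ, FiniteDimensional K (A.eig a n)) ∧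
  A.eig a 0 = Submodule.span K {A.vac}

/-- `a` is a conformal vector of strong CFT type: of CFT type and `a(2)V_1^a = 0`
(i.e. `L^a(1) V_1^a = 0`). -/
def IsConformalSCFT (A : VA K V) (a : V) : Prop :=
  A.IsConformalCFT a ∧ ∀ v ∈ A.eig a 1, A.ncoef 2 a v = 0

/-- A vertex algebra homomorphism: a linear map preserving all products and the vacuum. -/
structure IsVAHom (A : VA K V) (f : V → V) : Prop where
  map_add : ∀ a b : V, f (a + b) = f a + f b
  map_smul : ∀ (c : K) (a : V), f (c • a) = c • f a
  map_ncoef : ∀ (n : ℤ) (a b : V), f (A.ncoef n a b) = A.ncoef n (f a) (f b)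
  map_vac : f A.vac = A.vac

/-- A vertex algebra automorphism: a bijective vertex algebra homomorphism. -/
def IsVAAut (A : VA K V) (f : V → V) : Prop :=
  A.IsVAHom f ∧ Function.Bijective f

/-- A (two-sided) ideal of a vertex algebra. -/
def IsIdeal (A : VA K V) (I : Submodule K V) : Prop :=
  ∀ (n : ℤ) (a : V), ∀ b ∈ I, A.ncoef n a b ∈ I ∧ A.ncoef n b a ∈ I

/-- A vertex algebra is simple if it has no ideals other than `0` and itself. -/
def IsSimple (A : VA K V) : Prop :=
  ∀ I : Submodule K V, A.IsIdeal I → I = ⊥ ∨ I = ⊤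

end VA

/-- The exponential `exp f = Σ_{n≥0} f^n / n!` of an endomorphism, as a function
(meaningful for locally nilpotent `f`). -/
def expOp {K V : Type*} [Field K] [AddCommGroup V] [Module K V]
    (f : V →ₗ[K] V) (v : V) : V :=
  ∑ᶠ n : ℕ, (Nat.factorial n : K)⁻¹ • (f ^ n) v

/-- A ℤ-grading on a vertex algebra, making it a ℤ-graded vertex algebra:
`V = ⊕_{n ∈ ℤ} V_n`, `V_n(k)V_m ⊆ V_{n+m-k-1}` and `𝟙 ∈ V_0`. -/
structure GradedVA {K V : Type*} [Field K] [AddCommGroup V] [Module K V] (A : VA K V) where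
  /-- the grading subspaces `V_n` -/
  gr : ℤ → Submodule K V
  /-- `V = ⊕_{n ∈ ℤ} V_n` -/
  decomp : DirectSum.Decomposition gr
  /-- `𝟙 ∈ V_0` -/
  vac_mem : A.vac ∈ gr 0
  /-- `V_n(k)V_m ⊆ V_{n+m-k-1}` -/
  ncoef_mem : ∀ (n m k : ℤ), ∀ a ∈ gr n, ∀ b ∈ gr m, A.ncoef k a b ∈ gr (n + m - k - 1)

namespace GradedVA

variable {K V : Type*} [Field K] [AddCommGroup V] [Module K V] {A : VA K V}

/-- The canonical projection `pr_n : V → V_n`. -/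
def pr (G : GradedVA A) (n : ℤ) (v : V) : V :=
  letI := G.decomp
  (DirectSum.decompose G.gr v n : V)

/-- `V_{≥n} = ⊕_{i ≥ n} V_i`. -/
def ge (G : GradedVA A) (n : ℤ) : Submodule K V := ⨆ i ≥ n, G.gr i

/-- `V_{≤n} = ⊕_{i ≤ n} V_i`. -/
def le (G : GradedVA A) (n : ℤ) : Submodule K V := ⨆ i ≤ n, G.gr i

/-- `J_1(V) = {a ∈ V_1 | a(0) = 0}`. -/
def J1 (G : GradedVA A) : Set V :=
  {a : V | a ∈ G.gr 1 ∧ A.ncoef 0 a = 0}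

/-- `Aut⁺V`: automorphisms `f` with `f(V_n) ⊆ V_{≥n}` and `pr_n ∘ f|_{V_n} = id`. -/
def AutPlus (G : GradedVA A) (f : V → V) : Prop :=
  A.IsVAAut f ∧ ∀ n : ℤ, ∀ v ∈ G.gr n, f v ∈ G.ge n ∧ G.pr n (f v) = v

/-- `Aut⁻V`: automorphisms `f` with `f(V_n) ⊆ ⊕_{k ≤ n} V_k` and `pr_n ∘ f|_{V_n} = id`. -/
def AutMinus (G : GradedVA A) (f : V → V) : Prop :=
  A.IsVAAut f ∧ ∀ n : ℤ, ∀ v ∈ G.gr n, f v ∈ G.le n ∧ G.pr n (f v) = v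

/-- `Aut⁰V`: automorphisms `f` with `f(V_n) ⊆ V_n`. -/
def AutZero (G : GradedVA A) (f : V → V) : Prop :=
  A.IsVAAut f ∧ ∀ n : ℤ, ∀ v ∈ G.gr n, f v ∈ G.gr n

end GradedVA

/-- A ℤ-graded conformal vertex algebra: a ℤ-graded vertex algebra with a conformal
vector `ω ∈ V_2` whose modes `L(n) = ω(n+1)` satisfy the Virasoro relations, with
`L(0)v = n v` for `v ∈ V_n` and `L(-1) = T`. -/
structure ConfGVA {K V : Type*} [Field K] [AddCommGroup V] [Module K V] (A : VA K V)
    extends GradedVA A where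
  /-- the conformal vector -/
  ω : V
  ω_mem : ω ∈ gr 2
  /-- the Virasoro relations `[L(n), L(m)] = (n-m)L(n+m) + δ_{n+m,0}((n³-n)/12)c` -/
  virasoro : ∃ c : K, ∀ n m : ℤ,
    A.ncoef (n + 1) ω ∘ₗ A.ncoef (m + 1) ω - A.ncoef (m + 1) ω ∘ₗ A.ncoef (n + 1) ω
      = ((n : K) - (m : K)) • A.ncoef (n + m + 1) ω
        + (if n + m = 0 then ((n : K) ^ 3 - (n : K)) / 12 * c else 0)
            • (LinearMap.id : V →ₗ[K] V)
  /-- `L(0) v = n v` for `v ∈ V_n` -/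
  L0_grading : ∀ n : ℤ, ∀ v ∈ gr n, A.ncoef 1 ω v = (n : K) • v
  /-- `L(-1) = T` -/
  Lneg1_eq_T : A.ncoef 0 ω = A.T

namespace ConfGVA

variable {K V : Type*} [Field K] [AddCommGroup V] [Module K V] {A : VA K V}

abbrev pr (C : ConfGVA A) : ℤ → V → V := C.toGradedVA.pr
abbrev ge (C : ConfGVA A) : ℤ → Submodule K V := C.toGradedVA.ge
abbrev le (C : ConfGVA A) : ℤ → Submodule K V := C.toGradedVA.le
abbrev J1 (C : ConfGVA A) : Set V := C.toGradedVA.J1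
abbrev AutPlus (C : ConfGVA A) : (V → V) → Prop := C.toGradedVA.AutPlus
abbrev AutMinus (C : ConfGVA A) : (V → V) → Prop := C.toGradedVA.AutMinus
abbrev AutZero (C : ConfGVA A) : (V → V) → Prop := C.toGradedVA.AutZero

/-- `Aut_ω V`: the VOA automorphisms, i.e. the stabilizer of `ω` in `Aut V`. -/
def AutOmega (C : ConfGVA A) (f : V → V) : Prop :=
  A.IsVAAut f ∧ f C.ω = C.ω

/-- An invariant bilinear form on `(V, ω)`:
`(a(n)b, c) = (-1)^d Σ_{j≥0} (1/j!) (b, (L(1)^j a)(2d-n-2-j) c)` for `a ∈ V_d`, which is the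
coefficient form of `(Y(a,z)b, c) = (b, Y(e^{zL(1)}(-z^{-2})^{L(0)} a, z^{-1}) c)`. -/
def IsInvForm (C : ConfGVA A) (B : V →ₗ[K] V →ₗ[K] K) : Prop :=
  ∀ d : ℤ, ∀ a ∈ C.gr d, ∀ (b c : V) (n : ℤ),
    B (A.ncoef n a b) c
      = ((d.negOnePow : ℤ) : K) *
          ∑ᶠ j : ℕ, (Nat.factorial j : K)⁻¹ *
            B b (A.ncoef (2 * d - n - 2 - (j : ℤ)) ((A.ncoef 2 C.ω ^ j) a) c)

end ConfGVA

/-- A VOA of CFT type: a ℤ-graded conformal vertex algebra with `V = ⊕_{n ∈ ℕ} V_n`,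
`dim V_n < ∞`, and `V_0 = K𝟙`. -/
structure VOACFT {K V : Type*} [Field K] [AddCommGroup V] [Module K V] (A : VA K V)
    extends ConfGVA A where
  gr_neg : ∀ n : ℤ, n < 0 → gr n = ⊥
  gr_fd : ∀ n : ℤ, FiniteDimensional K (gr n)
  gr_zero : gr 0 = Submodule.span K {A.vac}

namespace VOACFT

variable {K V : Type*} [Field K] [AddCommGroup V] [Module K V] {A : VA K V}

abbrev pr (W : VOACFT A) : ℤ → V → V := W.toConfGVA.pr
abbrev ge (W : VOACFT A) : ℤ → Submodule K V := W.toConfGVA.ge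
abbrev le (W : VOACFT A) : ℤ → Submodule K V := W.toConfGVA.le
abbrev J1 (W : VOACFT A) : Set V := W.toConfGVA.J1
abbrev AutPlus (W : VOACFT A) : (V → V) → Prop := W.toConfGVA.AutPlus
abbrev AutMinus (W : VOACFT A) : (V → V) → Prop := W.toConfGVA.AutMinus
abbrev AutZero (W : VOACFT A) : (V → V) → Prop := W.toConfGVA.AutZero
abbrev AutOmega (W : VOACFT A) : (V → V) → Prop := W.toConfGVA.AutOmega
abbrev IsInvForm (W : VOACFT A) : (V →ₗ[K] V →ₗ[K] K) → Prop := W.toConfGVA.IsInvForm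

end VOACFT

/-- A VOA of strong CFT type: a VOA of CFT type with `L(1)V_1 = 0`. -/
structure VOAsCFT {K V : Type*} [Field K] [AddCommGroup V] [Module K V] (A : VA K V)
    extends VOACFT A where
  L1_V1 : ∀ v ∈ gr 1, A.ncoef 2 ω v = 0

namespace VOAsCFT

variable {K V : Type*} [Field K] [AddCommGroup V] [Module K V] {A : VA K V}

abbrev pr (W : VOAsCFT A) : ℤ → V → V := W.toVOACFT.pr
abbrev ge (W : VOAsCFT A) : ℤ → Submodule K V := W.toVOACFT.ge
abbrev le (W : VOAsCFT A) : ℤ → Submodule K V := W.toVOACFT.le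
abbrev J1 (W : VOAsCFT A) : Set V := W.toVOACFT.J1
abbrev AutPlus (W : VOAsCFT A) : (V → V) → Prop := W.toVOACFT.AutPlus
abbrev AutMinus (W : VOAsCFT A) : (V → V) → Prop := W.toVOACFT.AutMinus
abbrev AutZero (W : VOAsCFT A) : (V → V) → Prop := W.toVOACFT.AutZero
abbrev AutOmega (W : VOAsCFT A) : (V → V) → Prop := W.toVOACFT.AutOmega
abbrev IsInvForm (W : VOAsCFT A) : (V →ₗ[K] V →ₗ[K] K) → Prop := W.toVOACFT.IsInvForm

end VOAsCFT

end

section Exponential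

variable {K V W : Type*} [Field K] [AddCommGroup V] [Module K V] [AddCommGroup W] [Module K W]

theorem pow_apply_eq_zero_of_le {f : V →ₗ[K] V} {v : V} {M N : ℕ} (hMN : M ≤ N)
    (h : (f ^ M) v = 0) : (f ^ N) v = 0 := by
  rw [← Nat.sub_add_cancel hMN, pow_add, Module.End.mul_apply, h, map_zero]

theorem expOp_eq_sum {f : V →ₗ[K] V} {v : V} {N : ℕ} (h : (f ^ N) v = 0) :
    expOp f v = ∑ n ∈ Finset.range N, (Nat.factorial n : K)⁻¹ • (f ^ n) v := by
  refine finsum_eq_sum_of_support_subset _ fun n hn => ?_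
  by_contra hlt
  simp only [Finset.coe_range, Set.mem_Iio, not_lt] at hlt
  exact hn (by simp [pow_apply_eq_zero_of_le hlt h])

theorem expOp_map_add {f : V →ₗ[K] V} (hf : ∀ v, ∃ N, (f ^ N) v = 0) (v w : V) :
    expOp f (v + w) = expOp f v + expOp f w := by
  obtain ⟨M, hM⟩ := hf v
  obtain ⟨N, hN⟩ := hf w
  have hv := pow_apply_eq_zero_of_le (le_max_left M N) hM
  have hw := pow_apply_eq_zero_of_le (le_max_right M N) hN
  have hvw : (f ^ max M N) (v + w) = 0 := by rw [map_add, hv, hw, add_zero]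
  rw [expOp_eq_sum hv, expOp_eq_sum hw, expOp_eq_sum hvw, ← Finset.sum_add_distrib]
  simp only [map_add, smul_add]

theorem expOp_map_smul {f : V →ₗ[K] V} (hf : ∀ v, ∃ N, (f ^ N) v = 0) (c : K) (v : V) :
    expOp f (c • v) = c • expOp f v := by
  obtain ⟨N, hN⟩ := hf v
  have hcv : (f ^ N) (c • v) = 0 := by rw [map_smul, hN, smul_zero]
  rw [expOp_eq_sum hN, expOp_eq_sum hcv, Finset.smul_sum]
  simp only [map_smul, smul_comm c]

theorem expOp_apply_of_map_eq_zero {f : V →ₗ[K] V} {v : V} (h : f v = 0) : expOp f v = v := by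
  rw [expOp_eq_sum (N := 1) (by simpa using h)]
  simp

theorem map_expOp_of_intertwine {f : V →ₗ[K] V} {g : W →ₗ[K] W} (φ : V →ₗ[K] W)
    (hf : ∀ v, ∃ N, (f ^ N) v = 0) (h : ∀ v, φ (f v) = g (φ v)) (v : V) :
    φ (expOp f v) = expOp g (φ v) := by
  have hpow : ∀ n v, φ ((f ^ n) v) = (g ^ n) (φ v) := by
    intro n
    induction n with
    | zero => simp
    | succ n ih => intro v; rw [pow_succ, pow_succ, Module.End.mul_apply, ih, h]; rfl
  obtain ⟨N, hN⟩ := hf v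
  rw [expOp_eq_sum hN, expOp_eq_sum (N := N) (by rw [← hpow, hN, map_zero]), map_sum]
  simp only [map_smul, hpow]

theorem expOp_add_of_commute [CharZero K] {f g : V →ₗ[K] V} (hfg : Commute f g)
    (hf : ∀ v, ∃ N, (f ^ N) v = 0) (hg : ∀ v, ∃ N, (g ^ N) v = 0) (v : V) :
    expOp (f + g) v = expOp f (expOp g v) := by
  obtain ⟨M, hM⟩ := hf v
  obtain ⟨N, hN⟩ := hg v
  have hfz : ∀ i j, M ≤ i → (f ^ i) ((g ^ j) v) = 0 := fun i j hi => by
    rw [← Module.End.mul_apply, (hfg.pow_pow i j).eq, Module.End.mul_apply,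
      pow_apply_eq_zero_of_le hi hM, map_zero]
  have hgz : ∀ i j, N ≤ j → (f ^ i) ((g ^ j) v) = 0 := fun i j hj => by
    rw [pow_apply_eq_zero_of_le hj hN, map_zero]
  have hbinom : ∀ n, (Nat.factorial n : K)⁻¹ • ((f + g) ^ n) v =
      ∑ p ∈ Finset.HasAntidiagonal.antidiagonal n, (Nat.factorial p.1 : K)⁻¹ • (Nat.factorial p.2 : K)⁻¹ •
        (f ^ p.1) ((g ^ p.2) v) := by
    intro n
    rw [hfg.add_pow', LinearMap.sum_apply, Finset.smul_sum]
    refine Finset.sum_congr rfl fun p hp => ?_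
    rw [Finset.HasAntidiagonal.mem_antidiagonal] at hp
    rw [LinearMap.smul_apply, Module.End.mul_apply, ← Nat.cast_smul_eq_nsmul K, smul_smul,
      smul_smul, ← hp, Nat.choose_symm_add, Nat.add_choose, Nat.cast_div (Nat.factorial_mul_factorial_dvd_factorial_add _ _)
        (by exact_mod_cast (mul_ne_zero (Nat.factorial_ne_zero _) (Nat.factorial_ne_zero _)))]
    congr 1
    have h0 : ((p.1 + p.2).factorial : K) ≠ 0 := by exact_mod_cast Nat.factorial_ne_zero _
    push_cast
    field_simp
  have hsum : ((f + g) ^ (M + N)) v = 0 := by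
    rw [hfg.add_pow', LinearMap.sum_apply]
    refine Finset.sum_eq_zero fun p hp => ?_
    rw [Finset.HasAntidiagonal.mem_antidiagonal] at hp
    rw [LinearMap.smul_apply, Module.End.mul_apply]
    rcases le_or_gt M p.1 with h | h
    · rw [hfz _ _ h, smul_zero]
    · rw [hgz _ _ (by omega), smul_zero]
  have hM' : (f ^ M) (expOp g v) = 0 := by
    rw [expOp_eq_sum hN, map_sum]
    exact Finset.sum_eq_zero fun j _ => by rw [map_smul, hfz _ _ le_rfl, smul_zero]
  rw [expOp_eq_sum hsum, expOp_eq_sum hM', expOp_eq_sum hN]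
  simp only [hbinom, map_sum, map_smul, Finset.smul_sum]
  rw [← Finset.sum_product', Finset.sum_sigma']
  symm
  refine Finset.sum_bij_ne_zero (fun p _ _ => ⟨p.1 + p.2, p⟩) ?_ ?_ ?_ ?_
  · intro p hp _
    simp only [Finset.mem_product, Finset.mem_range] at hp
    simp only [Finset.mem_sigma, Finset.mem_range, Finset.HasAntidiagonal.mem_antidiagonal, and_true]
    omega
  · intro p _ _ q _ _ h
    simp only [Sigma.mk.injEq] at h
    exact eq_of_heq h.2
  · rintro ⟨n, p⟩ hp hne
    simp only [Finset.mem_sigma, Finset.mem_range, Finset.HasAntidiagonal.mem_antidiagonal] at hp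
    obtain ⟨-, rfl⟩ := hp
    refine ⟨p, ?_, hne, rfl⟩
    simp only [Finset.mem_product, Finset.mem_range]
    by_contra hcon
    rcases not_and_or.mp hcon with h | h
    · exact hne (by rw [hfz _ _ (not_lt.mp h), smul_zero, smul_zero])
    · exact hne (by rw [hgz _ _ (not_lt.mp h), smul_zero, smul_zero])
  · intros
    rfl

theorem expOp_bilinear_of_derivation [CharZero K] {D : V →ₗ[K] V}
    (hD : ∀ v, ∃ N, (D ^ N) v = 0) (B : V →ₗ[K] V →ₗ[K] V)
    (hB : ∀ a b, D (B a b) = B (D a) b + B a (D b)) (a b : V) :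
    expOp D (B a b) = B (expOp D a) (expOp D b) := by
  let f : TensorProduct K V V →ₗ[K] TensorProduct K V V := D.rTensor V
  let g : TensorProduct K V V →ₗ[K] TensorProduct K V V := D.lTensor V
  have hadd : ∀ (h : TensorProduct K V V →ₗ[K] TensorProduct K V V) (x y : TensorProduct K V V),
      (∃ N, (h ^ N) x = 0) → (∃ N, (h ^ N) y = 0) → ∃ N, (h ^ N) (x + y) = 0 := by
    rintro h x y ⟨M, hM⟩ ⟨N, hN⟩
    refine ⟨max M N, ?_⟩
    rw [map_add, pow_apply_eq_zero_of_le (le_max_left M N) hM,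
      pow_apply_eq_zero_of_le (le_max_right M N) hN, add_zero]
  have hf : ∀ x, ∃ N, (f ^ N) x = 0 := by
    intro x
    induction x using TensorProduct.induction_on with
    | zero => exact ⟨0, map_zero _⟩
    | tmul v w =>
      obtain ⟨N, hN⟩ := hD v
      exact ⟨N, by simp only [f, LinearMap.rTensor_pow, LinearMap.rTensor_tmul, hN,
        TensorProduct.zero_tmul]⟩
    | add x y hx hy => exact hadd f x y hx hy
  have hg : ∀ x, ∃ N, (g ^ N) x = 0 := by
    intro x
    induction x using TensorProduct.induction_on with
    | zero => exact ⟨0, map_zero _⟩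
    | tmul v w =>
      obtain ⟨N, hN⟩ := hD w
      exact ⟨N, by simp only [g, LinearMap.lTensor_pow, LinearMap.lTensor_tmul, hN,
        TensorProduct.tmul_zero]⟩
    | add x y hx hy => exact hadd g x y hx hy
  have hfg : Commute f g := by
    refine TensorProduct.ext' fun v w => ?_
    simp [f, g]
  have hintertwine : ∀ x, TensorProduct.lift B ((f + g) x) = D (TensorProduct.lift B x) := by
    intro x
    induction x using TensorProduct.induction_on with
    | zero => simp
    | tmul v w => simp [f, g, hB]
    | add x y hx hy => rw [map_add, map_add, hx, hy, map_add, map_add]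
  have hnil : ∀ x, ∃ N, ((f + g) ^ N) x = 0 := by
    intro x
    obtain ⟨M, hM⟩ := hf x
    obtain ⟨N, hN⟩ := hg x
    refine ⟨M + N, ?_⟩
    rw [hfg.add_pow', LinearMap.sum_apply]
    refine Finset.sum_eq_zero fun p hp => ?_
    rw [Finset.HasAntidiagonal.mem_antidiagonal] at hp
    rw [LinearMap.smul_apply]
    rcases le_or_gt M p.1 with h | h
    · rw [(hfg.pow_pow p.1 p.2).eq, Module.End.mul_apply, pow_apply_eq_zero_of_le h hM, map_zero,
        smul_zero]
    · rw [Module.End.mul_apply, pow_apply_eq_zero_of_le (by omega) hN, map_zero, smul_zero]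
  have hleft : ∀ v w, expOp f (v ⊗ₜ[K] w) = expOp D v ⊗ₜ[K] w := fun v w =>
    (map_expOp_of_intertwine ((TensorProduct.mk K V V).flip w) hD (fun _ => rfl) v).symm
  have hright : ∀ v w, expOp g (v ⊗ₜ[K] w) = v ⊗ₜ[K] expOp D w := fun v w =>
    (map_expOp_of_intertwine (TensorProduct.mk K V V v) hD (fun _ => rfl) w).symm
  have key := map_expOp_of_intertwine (TensorProduct.lift B) hnil hintertwine (a ⊗ₜ[K] b)
  rw [expOp_add_of_commute hfg hf hg, hright, hleft, TensorProduct.lift.tmul,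
    TensorProduct.lift.tmul] at key
  exact key.symm

end Exponential

section ZBinom

variable {K : Type*} [Field K]

theorem zBinom_zero_right (m : ℤ) : zBinom K m 0 = 1 := by simp [zBinom]

theorem zBinom_natCast_of_lt {m i : ℕ} (h : m < i) : zBinom K (m : ℤ) i = 0 := by
  rw [zBinom, Finset.prod_eq_zero (Finset.mem_range.mpr h) (by simp), zero_div]

theorem zBinom_one_one : zBinom K 1 1 = 1 := by simp [zBinom]

end ZBinom

namespace VA

variable {K V : Type*} [Field K] [AddCommGroup V] [Module K V] (A : VA K V)

theorem commutator_one (a b c : V) (q : ℤ) :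
    A.ncoef 1 a (A.ncoef q b c) - A.ncoef q b (A.ncoef 1 a c)
      = A.ncoef (1 + q) (A.ncoef 0 a b) c + A.ncoef q (A.ncoef 1 a b) c := by
  have h := A.borcherds a b c 0 q 1
  rw [finsum_eq_sum_of_support_subset (s := Finset.range 2) _ ?_, Finset.sum_range_succ,
    Finset.sum_range_one, finsum_eq_single _ 0 ?_] at h
  · simpa [zBinom_zero_right, zBinom_one_one] using h.symm
  · intro i hi
    have : zBinom K 0 i = 0 := zBinom_natCast_of_lt (m := 0) (Nat.pos_of_ne_zero hi)
    rw [this, mul_zero, zero_smul]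
  · intro i hi
    by_contra hlt
    simp only [Finset.coe_range, Set.mem_Iio, not_lt] at hlt
    have : zBinom K 1 i = 0 := zBinom_natCast_of_lt (m := 1) hlt
    exact hi (by simp [this])

theorem ncoef_one_derivation {a : V} (ha : A.ncoef 0 a = 0) (q : ℤ) (b c : V) :
    A.ncoef 1 a (A.ncoef q b c)
      = A.ncoef q (A.ncoef 1 a b) c + A.ncoef q b (A.ncoef 1 a c) := by
  have h := A.commutator_one a b c q
  rw [ha, LinearMap.zero_apply, map_zero, LinearMap.zero_apply, zero_add] at h
  rw [← h, sub_add_cancel]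

theorem ncoef_one_skew {a b : V} (h2 : ∀ n : ℤ, 2 ≤ n → (A.ncoef (-n) (A.ncoef n a b) A.vac) = 0) :
    A.ncoef 1 b a = A.ncoef 1 a b := by
  have h := A.borcherds a b A.vac 1 0 (-1)
  rw [finsum_eq_single _ 0 ?_, finsum_eq_single _ 0 ?_] at h
  · simpa [zBinom_zero_right, A.ncoef_vac, A.ncoef_vac_zero] using h.symm
  · intro i hi
    have hi' : (0 : ℤ) ≤ -1 + i := by omega
    rw [A.ncoef_vac_zero (0 + i) (by omega), A.ncoef_vac_zero _ hi']
    simp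
  · intro i hi
    have := h2 (1 + i) (by omega)
    rw [show -(1 + (i : ℤ)) = -1 + 0 - i by ring] at this
    rw [this, smul_zero]

end VA

namespace GradedVA

variable {K V : Type*} [Field K] [AddCommGroup V] [Module K V] {A : VA K V} (G : GradedVA A)

theorem pr_add (n : ℤ) (v w : V) : G.pr n (v + w) = G.pr n v + G.pr n w := by
  let _ := G.decomp
  simp [pr]

theorem pr_smul (n : ℤ) (c : K) (v : V) : G.pr n (c • v) = c • G.pr n v := by
  let _ := G.decomp
  simp only [pr, DirectSum.decompose_smul]
  rfl

/-- The projection `pr_n` as a linear map. -/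
def prLinear (n : ℤ) : V →ₗ[K] V := ⟨⟨G.pr n, G.pr_add n⟩, G.pr_smul n⟩

theorem pr_zero (n : ℤ) : G.pr n 0 = 0 :=
  map_zero (G.prLinear n)

theorem pr_mem (n : ℤ) (v : V) : G.pr n v ∈ G.gr n := by
  let _ := G.decomp
  exact SetLike.coe_mem _

theorem pr_of_mem {n : ℤ} {v : V} (h : v ∈ G.gr n) : G.pr n v = v := by
  let _ := G.decomp
  exact DirectSum.decompose_of_mem_same _ h

theorem pr_of_mem_ne {m n : ℤ} {v : V} (h : v ∈ G.gr n) (hne : n ≠ m) : G.pr m v = 0 := by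
  let _ := G.decomp
  exact DirectSum.decompose_of_mem_ne _ h hne

theorem ext_pr {v w : V} (h : ∀ n, G.pr n v = G.pr n w) : v = w := by
  let _ := G.decomp
  apply (DirectSum.decompose G.gr).injective
  refine DFinsupp.ext fun n => Subtype.ext (h n)

theorem induction {P : V → Prop} (h0 : P 0) (hom : ∀ n, ∀ v ∈ G.gr n, P v)
    (hadd : ∀ v w, P v → P w → P (v + w)) (v : V) : P v := by
  let _ := G.decomp
  exact DirectSum.Decomposition.inductionOn G.gr h0 (fun m => hom _ m m.2) hadd v

theorem mem_le {m n : ℤ} (h : m ≤ n) {v : V} (hv : v ∈ G.gr m) : v ∈ G.le n :=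
  Submodule.mem_iSup_of_mem m (Submodule.mem_iSup_of_mem h hv)

theorem pr_of_mem_le {m n : ℤ} (h : n < m) {v : V} (hv : v ∈ G.le n) : G.pr m v = 0 := by
  have : G.le n ≤ LinearMap.ker (G.prLinear m) := iSup₂_le fun i hi x hx => G.pr_of_mem_ne hx (by omega)
  exact this hv

/-- A homogeneous element of degree `d` acts by its `k`-th product as an operator of degree
`d - k - 1`. -/
theorem pr_ncoef {d k : ℤ} {a : V} (ha : a ∈ G.gr d) (m : ℤ) (v : V) :
    G.pr m (A.ncoef k a v) = A.ncoef k a (G.pr (m - d + k + 1) v) := by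
  induction v using G.induction with
  | h0 => simp [pr_zero]
  | hom n v hv =>
    have hmem := G.ncoef_mem d n k a ha v hv
    by_cases hn : n = m - d + k + 1
    · subst hn
      rw [G.pr_of_mem hv]
      apply G.pr_of_mem
      convert hmem using 2
      ring
    · rw [G.pr_of_mem_ne hv hn, map_zero, G.pr_of_mem_ne hmem (by omega)]
  | hadd v w hv hw => rw [map_add, pr_add, hv, hw, pr_add, map_add]

theorem pow_ncoef_one_mem {a : V} (ha : a ∈ G.gr 1) {n : ℤ} {v : V} (hv : v ∈ G.gr n) (k : ℕ) :
    (A.ncoef 1 a ^ k) v ∈ G.gr (n - k) := by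
  induction k with
  | zero => simpa using hv
  | succ k ih =>
    rw [pow_succ', Module.End.mul_apply]
    convert G.ncoef_mem 1 _ 1 a ha _ ih using 2
    push_cast
    ring

end GradedVA

namespace VOACFT

variable {K V : Type*} [Field K] [AddCommGroup V] [Module K V] {A : VA K V} (W : VOACFT A)

theorem eq_zero_of_mem_gr_neg {n : ℤ} (hn : n < 0) {v : V} (hv : v ∈ W.gr n) : v = 0 := by
  rwa [W.gr_neg n hn, Submodule.mem_bot] at hv

theorem ncoef_eq_zero_of_mem_gr_zero {v : V} (hv : v ∈ W.gr 0) {n : ℤ} (hn : n ≠ -1) :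
    A.ncoef n v = 0 := by
  rw [W.gr_zero, Submodule.mem_span_singleton] at hv
  obtain ⟨c, rfl⟩ := hv
  ext w
  simp [A.vac_ncoef, hn]

theorem ncoef_one_locally_nilpotent {a : V} (ha : a ∈ W.gr 1) (v : V) :
    ∃ N, (A.ncoef 1 a ^ N) v = 0 := by
  induction v using W.toGradedVA.induction with
  | h0 => exact ⟨0, map_zero _⟩
  | hom n v hv =>
    refine ⟨(n + 1).toNat, W.eq_zero_of_mem_gr_neg ?_ (W.pow_ncoef_one_mem ha hv _)⟩
    have := Int.self_le_toNat (n + 1)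
    omega
  | hadd v w hv hw =>
    obtain ⟨M, hM⟩ := hv
    obtain ⟨N, hN⟩ := hw
    refine ⟨max M N, ?_⟩
    rw [map_add, pow_apply_eq_zero_of_le (le_max_left M N) hM,
      pow_apply_eq_zero_of_le (le_max_right M N) hN, add_zero]

theorem commute_ncoef_one {a b : V} (ha : a ∈ W.J1) (hb : b ∈ W.gr 1) :
    Commute (A.ncoef 1 a) (A.ncoef 1 b) := by
  refine LinearMap.ext fun v => ?_
  have h0 : A.ncoef 1 a b ∈ W.gr 0 := by simpa using W.ncoef_mem 1 1 1 a ha.1 b hb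
  rw [Module.End.mul_apply, Module.End.mul_apply, A.ncoef_one_derivation ha.2,
    W.ncoef_eq_zero_of_mem_gr_zero h0 (by norm_num), LinearMap.zero_apply, zero_add]

theorem ncoef_one_omega {a : V} (ha : a ∈ W.gr 1) : A.ncoef 1 a W.ω = a := by
  rw [A.ncoef_one_skew (a := W.ω) (b := a), W.L0_grading 1 a ha, Int.cast_one, one_smul]
  intro n hn
  have hmem := W.ncoef_mem 2 1 n W.ω W.ω_mem a ha
  rcases hn.eq_or_lt with rfl | hn
  · rw [W.ncoef_eq_zero_of_mem_gr_zero (by simpa using hmem) (by norm_num),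
      LinearMap.zero_apply]
  · rw [W.eq_zero_of_mem_gr_neg (by omega) hmem, map_zero, LinearMap.zero_apply]

theorem expOp_mem_le {a : V} (ha : a ∈ W.gr 1) {n : ℤ} {v : V} (hv : v ∈ W.gr n) :
    expOp (A.ncoef 1 a) v ∈ W.le n := by
  obtain ⟨N, hN⟩ := W.ncoef_one_locally_nilpotent ha v
  rw [expOp_eq_sum hN]
  exact Submodule.sum_mem _ fun k _ => Submodule.smul_mem _ _
    (W.mem_le (by omega) (W.pow_ncoef_one_mem ha hv k))

theorem pr_expOp {a : V} (ha : a ∈ W.gr 1) {n : ℤ} {v : V} (hv : v ∈ W.gr n) (k : ℕ) :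
    W.toGradedVA.pr (n - k) (expOp (A.ncoef 1 a) v)
      = (Nat.factorial k : K)⁻¹ • (A.ncoef 1 a ^ k) v := by
  obtain ⟨N, hN⟩ := W.ncoef_one_locally_nilpotent ha v
  change W.toGradedVA.prLinear (n - k) _ = _
  have hN' := pow_apply_eq_zero_of_le (le_max_left N (k + 1)) hN
  rw [expOp_eq_sum hN', map_sum, Finset.sum_eq_single k, map_smul]
  · congr 1
    exact W.pr_of_mem (W.pow_ncoef_one_mem ha hv k)
  · intro j _ hj
    rw [map_smul]
    have : W.toGradedVA.prLinear (n - k) ((A.ncoef 1 a ^ j) v) = 0 :=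
      W.pr_of_mem_ne (W.pow_ncoef_one_mem ha hv j) (by omega)
    rw [this, smul_zero]
  · intro hk
    exact absurd (Finset.mem_range.mpr (by omega)) hk

theorem autMinus_expOp [CharZero K] {a : V} (ha : a ∈ W.J1) :
    W.AutMinus (expOp (A.ncoef 1 a)) := by
  have hnil := W.ncoef_one_locally_nilpotent ha.1
  have hneg : -a ∈ W.gr 1 := Submodule.neg_mem _ ha.1
  have hnil' := W.ncoef_one_locally_nilpotent hneg
  have hcomm := W.commute_ncoef_one ha hneg
  have hzero : ∀ v : V, expOp (0 : V →ₗ[K] V) v = v := fun v => expOp_apply_of_map_eq_zero rfl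
  refine ⟨⟨⟨expOp_map_add hnil, expOp_map_smul hnil, fun n =>
    expOp_bilinear_of_derivation hnil _ (A.ncoef_one_derivation ha.2 n),
    expOp_apply_of_map_eq_zero (A.ncoef_vac_zero 1 zero_le_one a)⟩, ?_⟩, ?_⟩
  · refine Function.bijective_iff_has_inverse.mpr ⟨expOp (A.ncoef 1 (-a)), fun v => ?_, fun v => ?_⟩
    · rw [← expOp_add_of_commute hcomm.symm hnil' hnil, map_neg, neg_add_cancel, hzero]
    · rw [← expOp_add_of_commute hcomm hnil hnil', map_neg, add_neg_cancel, hzero]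
  · intro n v hv
    refine ⟨W.expOp_mem_le ha.1 hv, ?_⟩
    simpa using W.pr_expOp ha.1 hv 0

theorem map_omega_eq {f : V → V} (hf : W.AutMinus f) :
    f W.ω = W.ω + W.toGradedVA.pr 1 (f W.ω) + W.toGradedVA.pr 0 (f W.ω) := by
  obtain ⟨hle, hpr⟩ := hf.2 2 W.ω W.ω_mem
  have h1 := W.pr_mem 1 (f W.ω)
  have h0 := W.pr_mem 0 (f W.ω)
  refine W.ext_pr fun m => ?_
  rw [W.pr_add, W.pr_add]
  by_cases m2 : m = 2
  · subst m2
    rw [W.pr_of_mem W.ω_mem, W.pr_of_mem_ne h1 (by norm_num), W.pr_of_mem_ne h0 (by norm_num),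
      add_zero, add_zero]
    exact hpr
  rw [W.pr_of_mem_ne W.ω_mem (Ne.symm m2), zero_add]
  by_cases m1 : m = 1
  · subst m1
    rw [W.pr_of_mem h1, W.pr_of_mem_ne h0 (by norm_num), add_zero]
  rw [W.pr_of_mem_ne h1 (Ne.symm m1), zero_add]
  by_cases m0 : m = 0
  · subst m0
    rw [W.pr_of_mem h0]
  rw [W.pr_of_mem_ne h0 (Ne.symm m0)]
  rcases lt_or_gt_of_ne m0 with hm | hm
  · exact W.eq_zero_of_mem_gr_neg hm (W.pr_mem m _)
  · exact W.pr_of_mem_le (by omega) hle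

theorem pr_one_map_omega_mem_J1 {f : V → V} (hf : W.AutMinus f) :
    W.toGradedVA.pr 1 (f W.ω) ∈ W.J1 := by
  refine ⟨W.pr_mem 1 _, LinearMap.ext fun v => ?_⟩
  obtain ⟨u, rfl⟩ := hf.1.2.2 v
  have h := hf.1.1.map_ncoef 0 W.ω u
  rw [W.map_omega_eq hf, map_add, map_add, LinearMap.add_apply, LinearMap.add_apply,
    W.ncoef_eq_zero_of_mem_gr_zero (W.pr_mem 0 _) (by norm_num), W.Lneg1_eq_T] at h
  have hT : f (A.T u) = A.T (f u) := by
    simp only [VA.T, LinearMap.flip_apply]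
    rw [hf.1.1.map_ncoef, hf.1.1.map_vac]
  rw [hT] at h
  simpa using h

theorem expOp_pr_one_map_omega [CharZero K] {f : V → V} (hf : W.AutMinus f) :
    expOp (A.ncoef 1 (W.toGradedVA.pr 1 (f W.ω))) = f := by
  set a := W.toGradedVA.pr 1 (f W.ω) with ha
  have haJ : a ∈ W.J1 := W.pr_one_map_omega_mem_J1 hf
  have hnil := W.ncoef_one_locally_nilpotent haJ.1
  have hom : ∀ n, ∀ v ∈ W.gr n, expOp (A.ncoef 1 a) v = f v := by
    intro n v hv
    have hcomp : ∀ k : ℕ, W.toGradedVA.pr (n - k) (f v)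
        = (Nat.factorial k : K)⁻¹ • (A.ncoef 1 a ^ k) v := by
      intro k
      induction k with
      | zero => simpa using (hf.2 n v hv).2
      | succ k ih =>
        have h := hf.1.1.map_ncoef 1 W.ω v
        rw [W.map_omega_eq hf, map_add, map_add, LinearMap.add_apply, LinearMap.add_apply,
          W.ncoef_eq_zero_of_mem_gr_zero (W.pr_mem 0 _) (by norm_num), LinearMap.zero_apply,
          add_zero, W.L0_grading n v hv, hf.1.1.map_smul, ← ha] at h
        have h' := congrArg (W.toGradedVA.pr (n - (k + 1 : ℕ))) h
        rw [W.pr_smul, W.pr_add, W.pr_ncoef W.ω_mem, W.pr_ncoef haJ.1,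
          show n - ((k + 1 : ℕ) : ℤ) - 2 + 1 + 1 = n - (k + 1 : ℕ) by ring,
          show n - ((k + 1 : ℕ) : ℤ) - 1 + 1 + 1 = n - k by push_cast; ring,
          W.L0_grading _ _ (W.pr_mem _ _), ih, map_smul, ← sub_eq_iff_eq_add', ← sub_smul] at h'
        have hcoef : (n : K) - ((n - (k + 1 : ℕ) : ℤ) : K) = k + 1 := by push_cast; ring
        rw [hcoef, ← Nat.cast_succ] at h'
        rw [pow_succ', Module.End.mul_apply, Nat.factorial_succ, Nat.cast_mul, mul_inv, mul_smul,
          ← h', inv_smul_smul₀ (Nat.cast_ne_zero.mpr k.succ_ne_zero)]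
    refine W.ext_pr fun m => ?_
    rcases le_or_gt m n with hm | hm
    · obtain ⟨k, hk⟩ := Int.eq_ofNat_of_zero_le (sub_nonneg.mpr hm)
      obtain rfl : m = n - k := by omega
      exact (W.pr_expOp haJ.1 hv k).trans (hcomp k).symm
    · rw [W.pr_of_mem_le hm (W.expOp_mem_le haJ.1 hv), W.pr_of_mem_le hm (hf.2 n v hv).1]
  funext v
  induction v using W.toGradedVA.induction with
  | h0 =>
    rw [expOp_apply_of_map_eq_zero (map_zero _)]
    simpa using (hf.1.1.map_smul 0 0).symm
  | hom n v hv => exact hom n v hv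
  | hadd v w hv hw => rw [expOp_map_add hnil, hv, hw, hf.1.1.map_add]

end VOACFT

/-- Proposition `Aut_m`: in a VOA of CFT type, the map
`J_1(V) → Aut⁻V`, `a ↦ exp(a(1))`, is an isomorphism of groups (from the additive group
`J_1(V)`): it lands in `Aut⁻V`, is a homomorphism, and is a bijection onto `Aut⁻V`. -/
theorem J1_exp_group_iso_autMinus {K V : Type*} [RCLike K]
    [AddCommGroup V] [Module K V]
    (A : VA K V) (W : VOACFT A) :
    (∀ a ∈ W.J1, W.AutMinus (expOp (A.ncoef 1 a))) ∧
    (∀ a ∈ W.J1, ∀ b ∈ W.J1,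
      expOp (A.ncoef 1 (a + b)) = expOp (A.ncoef 1 a) ∘ expOp (A.ncoef 1 b)) ∧
    Set.BijOn (fun a : V => expOp (A.ncoef 1 a)) W.J1 {f : V → V | W.AutMinus f} := by
  refine ⟨fun a ha => W.autMinus_expOp ha, fun a ha b hb => ?_, fun a ha => W.autMinus_expOp ha,
    fun a ha b hb hab => ?_, fun f hf =>
      ⟨_, W.pr_one_map_omega_mem_J1 hf, W.expOp_pr_one_map_omega hf⟩⟩
  · funext v
    rw [map_add]
    exact expOp_add_of_commute (W.commute_ncoef_one ha hb.1)
      (W.ncoef_one_locally_nilpotent ha.1) (W.ncoef_one_locally_nilpotent hb.1) v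
  · have h := congrArg (W.toGradedVA.pr (2 - (1 : ℕ))) (congrFun hab W.ω)
    dsimp only at h
    rw [W.pr_expOp ha.1 W.ω_mem, W.pr_expOp hb.1 W.ω_mem] at h
    simpa [W.ncoef_one_omega ha.1, W.ncoef_one_omega hb.1] using h
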